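/- Flow convexity of the cube: Assume hypothesis H(α,δ,ε) with 0 ≤ δ < α. Let (x, y) : [0,τ] → ℝ^s × ℝ^u be a C¹ solution of the straightened system taking values in C_{2ε}, and suppose both endpoints lie in the cube: (x(0), y(0)) ∈ C_ε and (x(τ), y(τ)) ∈ C_ε. Then (x(t), y(t)) ∈ C_ε for all t ∈ [0,τ]. -/

import Mathlib

open Set
open scoped InnerProductSpace

/-- The continuous linear map on Euclidean space induced by a square real matrix. -/
noncomputable def matCLM {n : ℕ} (M : Matrix (Fin n) (Fin n) ℝ) :
    EuclideanSpace ℝ (Fin n) →L[ℝ] EuclideanSpace ℝ (Fin n) :=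
  LinearMap.toContinuousLinearMap (Matrix.toEuclideanLin M)

section NormMonotone

variable {E : Type*} [NormedAddCommGroup E] [InnerProductSpace ℝ E]

/-- Along a curve whose velocity never points outwards, the norm does not increase. -/
lemma antitoneOn_norm_of_inner_deriv_nonpos {D : Set ℝ} (hD : Convex ℝ D) {x v : ℝ → E}
    (hx : ∀ t ∈ D, HasDerivWithinAt x (v t) D t) (hv : ∀ t ∈ D, ⟪v t, x t⟫_ℝ ≤ 0) :
    AntitoneOn (fun t => ‖x t‖) D := by
  have hanti : AntitoneOn (fun t => ‖x t‖ ^ 2) D :=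
    antitoneOn_of_hasDerivWithinAt_nonpos hD
      (fun t ht => (hx t ht).norm_sq.continuousWithinAt)
      (fun t ht => (hx t (interior_subset ht)).norm_sq.mono interior_subset)
      (fun t ht => by
        have := hv t (interior_subset ht)
        rw [real_inner_comm]
        linarith)
  exact fun a ha b hb hab => (sq_le_sq₀ (norm_nonneg _) (norm_nonneg _)).1 (hanti ha hb hab)

/-- Along a curve whose velocity never points inwards, the norm does not decrease. -/
lemma monotoneOn_norm_of_inner_deriv_nonneg {D : Set ℝ} (hD : Convex ℝ D) {x v : ℝ → E}
    (hx : ∀ t ∈ D, HasDerivWithinAt x (v t) D t) (hv : ∀ t ∈ D, 0 ≤ ⟪v t, x t⟫_ℝ) :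
    MonotoneOn (fun t => ‖x t‖) D := by
  have hmono : MonotoneOn (fun t => ‖x t‖ ^ 2) D :=
    monotoneOn_of_hasDerivWithinAt_nonneg hD
      (fun t ht => (hx t ht).norm_sq.continuousWithinAt)
      (fun t ht => (hx t (interior_subset ht)).norm_sq.mono interior_subset)
      (fun t ht => by
        have := hv t (interior_subset ht)
        rw [real_inner_comm]
        linarith)
  exact fun a ha b hb hab => (sq_le_sq₀ (norm_nonneg _) (norm_nonneg _)).1 (hmono ha hb hab)

lemma abs_inner_apply_self_le {A : E →L[ℝ] E} {c : ℝ} (hA : ‖A‖ ≤ c) (x : E) :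
    |⟪A x, x⟫_ℝ| ≤ c * ‖x‖ ^ 2 :=
  calc |⟪A x, x⟫_ℝ| ≤ ‖A x‖ * ‖x‖ := abs_real_inner_le_norm _ _
    _ ≤ (c * ‖x‖) * ‖x‖ := by gcongr; exact A.le_of_opNorm_le hA x
    _ = c * ‖x‖ ^ 2 := by ring

end NormMonotone

/-- **Flow convexity of the cube.** -/
theorem stmt_5 {s u : ℕ} (hs : 1 ≤ s) (hu : 1 ≤ u)
    (Lm : Matrix (Fin s) (Fin s) ℝ) (Lp : Matrix (Fin u) (Fin u) ℝ)
    (hLmsymm : Lm.IsSymm) (hLpsymm : Lp.IsSymm)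
    (ft : EuclideanSpace ℝ (Fin s) × EuclideanSpace ℝ (Fin u) → Matrix (Fin s) (Fin s) ℝ)
    (gt : EuclideanSpace ℝ (Fin s) × EuclideanSpace ℝ (Fin u) → Matrix (Fin u) (Fin u) ℝ)
    (hft : ContDiff ℝ 1 fun p => matCLM (ft p))
    (hgt : ContDiff ℝ 1 fun p => matCLM (gt p))
    (α δ ε : ℝ) (hδ : 0 ≤ δ) (hδα : δ < α) (hε : 0 < ε)
    (hLm : ∀ x : EuclideanSpace ℝ (Fin s), ⟪matCLM Lm x, x⟫_ℝ ≤ -α * ‖x‖ ^ 2)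
    (hLp : ∀ y : EuclideanSpace ℝ (Fin u), α * ‖y‖ ^ 2 ≤ ⟪matCLM Lp y, y⟫_ℝ)
    (hftδ : ∀ x y, max ‖x‖ ‖y‖ ≤ 2 * ε → ‖matCLM (ft (x, y))‖ ≤ δ)
    (hgtδ : ∀ x y, max ‖x‖ ‖y‖ ≤ 2 * ε → ‖matCLM (gt (x, y))‖ ≤ δ)
    (τ : ℝ) (hτ : 0 ≤ τ)
    (x : ℝ → EuclideanSpace ℝ (Fin s)) (y : ℝ → EuclideanSpace ℝ (Fin u))
    (hx : ∀ t ∈ Icc (0 : ℝ) τ,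
      HasDerivWithinAt x (matCLM Lm (x t) + matCLM (ft (x t, y t)) (x t)) (Icc 0 τ) t)
    (hy : ∀ t ∈ Icc (0 : ℝ) τ,
      HasDerivWithinAt y (matCLM Lp (y t) + matCLM (gt (x t, y t)) (y t)) (Icc 0 τ) t)
    (hvals : ∀ t ∈ Icc (0 : ℝ) τ, max ‖x t‖ ‖y t‖ ≤ 2 * ε)
    (h0 : max ‖x 0‖ ‖y 0‖ ≤ ε) (h1 : max ‖x τ‖ ‖y τ‖ ≤ ε) :
    ∀ t ∈ Icc (0 : ℝ) τ, max ‖x t‖ ‖y t‖ ≤ ε := by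
  have hanti := antitoneOn_norm_of_inner_deriv_nonpos (convex_Icc 0 τ) hx fun t ht => by
    have hf := (abs_le.1 (abs_inner_apply_self_le (hftδ _ _ (hvals t ht)) (x t))).2
    have hL := hLm (x t)
    rw [inner_add_left]
    nlinarith [sq_nonneg ‖x t‖]
  have hmono := monotoneOn_norm_of_inner_deriv_nonneg (convex_Icc 0 τ) hy fun t ht => by
    have hg := (abs_le.1 (abs_inner_apply_self_le (hgtδ _ _ (hvals t ht)) (y t))).1
    have hL := hLp (y t)
    rw [inner_add_left]
    nlinarith [sq_nonneg ‖y t‖]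
  intro t ht
  exact max_le ((hanti (left_mem_Icc.2 hτ) ht ht.1).trans ((le_max_left _ _).trans h0))
    ((hmono ht (right_mem_Icc.2 hτ) ht.2).trans ((le_max_right _ _).trans h1))
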